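/- arXiv:1111.5404 — 4 statements merged into one kernel-verified Lean document; each statement's English description precedes it below -/
import Mathlib

section
/- Let γ be a real number with 2 < γ < e and let ε > 0 be arbitrary. Then there exists a real number k₀ (depending only on γ and ε) such that for all sufficiently large x, the number of positive integers n ≤ x for which log p_k(n) > γ^{−k} log x holds for some natural number k ≥ k₀ is at most 2εx. -/
open Polynomial Filter
open scoped Classical

/-- Height of an integer polynomial: max absolute value of coefficients. -/
def polyHeight (f : Polynomial ℤ) : ℕ := f.support.sup fun i => (f.coeff i).natAbs

/-- A(n): height of the n-th cyclotomic polynomial. -/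
noncomputable def A (n : ℕ) : ℕ := polyHeight (Polynomial.cyclotomic n ℤ)

/-- B(n): max height over all integer polynomial divisors of x^n - 1. -/
noncomputable def B (n : ℕ) : ℕ :=
  sSup {h : ℕ | ∃ f : Polynomial ℤ, f ∣ (Polynomial.X ^ n - 1) ∧ polyHeight f = h}

/-- A₀(n): max of A(d) over positive divisors d of n. -/
noncomputable def A0 (n : ℕ) : ℕ := n.divisors.sup A

/-- τ(n): number of positive divisors of n. -/
def tau (n : ℕ) : ℕ := n.divisors.card

/-- ω(n): number of distinct prime factors of n. -/
def omegaCount (n : ℕ) : ℕ := n.primeFactors.card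

/-- p_k(n): the k-th largest distinct prime factor of n (1-indexed), or 1 if k > ω(n). -/
def pk (n k : ℕ) : ℕ :=
  if k ≤ n.primeFactors.card then
    (n.primeFactors.sort (· ≤ ·)).getD (n.primeFactors.card - k) 1
  else 1

/-- ω([t,x],n): number of distinct prime factors of n lying in the real interval [t,x]. -/
noncomputable def omegaInterval (t x : ℝ) (n : ℕ) : ℕ :=
  (n.primeFactors.filter fun p : ℕ => t ≤ (p : ℝ) ∧ (p : ℝ) ≤ x).card

/-- rad(n): the radical (product of the distinct prime factors) of n. -/
def rad (n : ℕ) : ℕ := ∏ p ∈ n.primeFactors, p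

theorem log_factorial_eq_sum_primes (N : ℕ) :
    Real.log (N.factorial : ℝ) =
      ∑ p ∈ (Finset.Ioc 0 N).filter Nat.Prime, (N.factorial.factorization p : ℝ) * Real.log p := by
  rw [Real.log_nat_eq_sum_factorization, Finsupp.sum]
  refine Finset.sum_subset (fun p hp => ?_) (fun p _ hp => ?_)
  · have hp' := Nat.prime_of_mem_primeFactors hp
    have := Nat.dvd_of_mem_primeFactors hp
    rw [hp'.dvd_factorial] at this
    simp [hp', this, hp'.pos]
  · rw [Finsupp.notMem_support_iff.mp hp]; simp

theorem sum_log_div_prime_le (N : ℕ) (hN : 0 < N) :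
    ∑ p ∈ (Finset.Ioc 0 N).filter Nat.Prime, Real.log p / p ≤ Real.log N + Real.log 4 := by
  have hN' : (0 : ℝ) < N := by exact_mod_cast hN
  have hle : (N : ℝ) * ∑ p ∈ (Finset.Ioc 0 N).filter Nat.Prime, Real.log p / p
      - Chebyshev.theta N ≤ Real.log (N.factorial : ℝ) := by
    rw [log_factorial_eq_sum_primes, Chebyshev.theta, Nat.floor_natCast, Finset.mul_sum,
      ← Finset.sum_sub_distrib]
    refine Finset.sum_le_sum fun p hp => ?_
    rw [Finset.mem_filter, Finset.mem_Ioc] at hp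
    have hlog : 0 ≤ Real.log p := Real.log_natCast_nonneg p
    have hv : N / p ≤ N.factorial.factorization p := by
      rw [Nat.factorization_factorial hp.2 (Nat.lt_add_one (Nat.log p N))]
      have h1 : 1 ∈ Finset.Ico 1 (Nat.log p N + 1) := by
        simpa using Nat.log_pos hp.2.one_lt hp.1.2
      simpa using Finset.single_le_sum (f := fun i => N / p ^ i) (fun i _ => Nat.zero_le _) h1
    have hv' : (N : ℝ) / p - 1 ≤ (N.factorial.factorization p : ℝ) := by
      have h2 := Nat.lt_floor_add_one ((N : ℝ) / p)
      rw [Nat.floor_div_eq_div] at h2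
      have h3 : ((N / p : ℕ) : ℝ) ≤ (N.factorial.factorization p : ℝ) := by exact_mod_cast hv
      linarith
    calc (N : ℝ) * (Real.log p / p) - Real.log p = ((N : ℝ) / p - 1) * Real.log p := by ring
      _ ≤ _ := by gcongr
  have hfac : Real.log (N.factorial : ℝ) ≤ N * Real.log N := by
    rw [← Real.log_pow]
    exact Real.log_le_log (by positivity) (by exact_mod_cast Nat.factorial_le_pow N)
  have htheta := Chebyshev.theta_le_log4_mul_x hN'.le
  refine le_of_mul_le_mul_left ?_ hN'
  linarith

theorem summable_log_div_mul_pred :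
    Summable fun n : ℕ => Real.log n / (n * (n - 1)) := by
  have hs : Summable fun n : ℕ => 4 * ((n : ℝ) ^ (3 / 2 : ℝ))⁻¹ :=
    (Real.summable_nat_rpow_inv.mpr (by norm_num)).mul_left 4
  refine hs.of_nonneg_of_le (fun n => ?_) (fun n => ?_)
  · rcases n with _ | n
    · simp
    · have := Real.log_natCast_nonneg (n + 1)
      push_cast at *
      rw [add_sub_cancel_right]
      positivity
  · rcases lt_or_ge n 2 with h | h
    · interval_cases n <;> norm_num
    · have h' : (2 : ℝ) ≤ n := by exact_mod_cast h
      have h0 : (0 : ℝ) < n := by linarith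
      have hl := Real.log_le_rpow_div h0.le (ε := 1 / 2) (by norm_num)
      have hr : (n : ℝ) ^ (3 / 2 : ℝ) * (n : ℝ) ^ (1 / 2 : ℝ) = n * n := by
        rw [← Real.rpow_add h0, show (3 / 2 + 1 / 2 : ℝ) = (2 : ℕ) by norm_num, Real.rpow_natCast]
        ring
      have hp : 0 < (n : ℝ) ^ (3 / 2 : ℝ) := by positivity
      rw [← div_eq_mul_inv, div_le_div_iff₀ (by nlinarith) hp]
      calc Real.log n * (n : ℝ) ^ (3 / 2 : ℝ)
          ≤ ((n : ℝ) ^ (1 / 2 : ℝ) / (1 / 2)) * (n : ℝ) ^ (3 / 2 : ℝ) := by gcongr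
        _ = 2 * (n * n) := by rw [← hr]; ring
        _ ≤ 4 * (n * (n - 1)) := by nlinarith

theorem le_sum_log_div_prime : ∃ C : ℝ, ∀ N : ℕ, 0 < N →
    Real.log N - C ≤ ∑ p ∈ (Finset.Ioc 0 N).filter Nat.Prime, Real.log p / p := by
  refine ⟨1 + ∑' n : ℕ, Real.log n / (n * (n - 1)), fun N hN => ?_⟩
  have hN' : (0 : ℝ) < N := by exact_mod_cast hN
  have hfac : N * Real.log N - N ≤ Real.log (N.factorial : ℝ) := by
    have h := Real.pow_div_factorial_le_exp (N : ℝ) hN'.le N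
    have h2 := Real.log_le_log (by positivity) h
    rw [Real.log_exp, Real.log_div (by positivity) (by positivity), Real.log_pow] at h2
    linarith
  have hsum : Real.log (N.factorial : ℝ) ≤
      N * (∑ p ∈ (Finset.Ioc 0 N).filter Nat.Prime, Real.log p / p +
        ∑ p ∈ (Finset.Ioc 0 N).filter Nat.Prime, Real.log p / (p * (p - 1))) := by
    rw [log_factorial_eq_sum_primes, ← Finset.sum_add_distrib, Finset.mul_sum]
    refine Finset.sum_le_sum fun p hp => ?_
    rw [Finset.mem_filter] at hp
    have hlog : 0 ≤ Real.log p := Real.log_natCast_nonneg p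
    have h1 : (1 : ℝ) < p := by exact_mod_cast hp.2.one_lt
    have h1' : (p : ℝ) - 1 ≠ 0 := by linarith
    have hv : (N.factorial.factorization p : ℝ) ≤ N / (p - 1) := by
      have h2 : (N.factorial.factorization p : ℝ) ≤ ((N / (p - 1) : ℕ) : ℝ) := by
        exact_mod_cast Nat.factorization_factorial_le_div_pred hp.2 N
      refine h2.trans (Nat.cast_div_le.trans_eq ?_)
      rw [Nat.cast_sub hp.2.one_lt.le, Nat.cast_one]
    calc _ ≤ (N : ℝ) / (p - 1) * Real.log p := by gcongr
      _ = _ := by field_simp; ring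
  have hts : ∑ p ∈ (Finset.Ioc 0 N).filter Nat.Prime, Real.log p / (p * (p - 1)) ≤
      ∑' n : ℕ, Real.log n / (n * (n - 1)) := by
    refine summable_log_div_mul_pred.sum_le_tsum _ fun n _ => ?_
    rcases n with _ | n
    · simp
    · have := Real.log_natCast_nonneg (n + 1)
      push_cast at *
      rw [add_sub_cancel_right]
      positivity
  have h3 : Real.log N - 1 ≤ ∑ p ∈ (Finset.Ioc 0 N).filter Nat.Prime, Real.log p / p +
        ∑ p ∈ (Finset.Ioc 0 N).filter Nat.Prime, Real.log p / (p * (p - 1)) := by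
    refine le_of_mul_le_mul_left ?_ hN'
    linarith
  linarith

theorem sum_mul_le_of_antitone {c f : ℕ → ℝ} {K : ℝ} {M : ℕ}
    (hf : ∀ n, M ≤ n → f (n + 1) ≤ f n)
    (hc : ∀ n, M ≤ n → ∑ m ∈ Finset.Ioc M n, c m ≤ K) {N : ℕ} (hMN : M ≤ N) :
    ∑ n ∈ Finset.Ioc M N, c n * f n + (K - ∑ n ∈ Finset.Ioc M N, c n) * f N ≤ K * f M := by
  induction N, hMN using Nat.le_induction with
  | base => simp
  | succ n hn ih =>
    rw [Finset.sum_Ioc_succ_top hn, Finset.sum_Ioc_succ_top hn]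
    nlinarith [hf n hn, hc n hn]

theorem sum_inv_prime_Ioc_le : ∃ C : ℝ, 0 ≤ C ∧ ∀ M N : ℕ, 2 ≤ M → M ≤ N →
    ∑ p ∈ (Finset.Ioc M N).filter Nat.Prime, (p : ℝ)⁻¹ ≤
      Real.log (Real.log N) - Real.log (Real.log M) + C := by
  obtain ⟨C, hC⟩ := le_sum_log_div_prime
  set K := |C + Real.log 4| with hK
  refine ⟨K * (Real.log 2)⁻¹, by positivity, fun M N hM hMN => ?_⟩
  have hlog : ∀ n, M ≤ n → 0 < Real.log n := fun n hn =>
    Real.log_pos (by exact_mod_cast (by omega : 1 < n))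
  set a : ℕ → ℝ := fun n => if n.Prime then Real.log n / n else 0 with ha
  set b : ℕ → ℝ := fun n => Real.log n - Real.log (n - 1 : ℕ) with hb
  have hbsum : ∀ n, M ≤ n → ∑ m ∈ Finset.Ioc M n, b m = Real.log n - Real.log M := by
    intro n hn
    induction n, hn using Nat.le_induction with
    | base => simp
    | succ n hn ih => rw [Finset.sum_Ioc_succ_top hn, ih]; simp [hb]
  have hasum : ∀ n, M ≤ n → ∑ m ∈ Finset.Ioc M n, a m ≤ Real.log n - Real.log M + K := by
    intro n hn
    have h1 := sum_log_div_prime_le n (by omega)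
    have h2 := hC M (by omega)
    rw [Finset.sum_filter] at h1 h2
    have h3 := Finset.sum_Ioc_consecutive a (Nat.zero_le M) hn
    have h4 := le_abs_self (C + Real.log 4)
    simp only [ha] at h3 ⊢
    linarith
  have hpart := sum_mul_le_of_antitone (c := fun n => a n - b n)
    (f := fun n => (Real.log n)⁻¹) (K := K) (M := M)
    (fun n hn => inv_anti₀ (hlog n hn) (Real.log_le_log
      (by exact_mod_cast (by omega : 0 < n)) (by push_cast; linarith)))
    (fun n hn => by rw [Finset.sum_sub_distrib, hbsum n hn]; linarith [hasum n hn]) hMN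
  have hnonneg : 0 ≤ (K - ∑ n ∈ Finset.Ioc M N, (a n - b n)) * (Real.log N)⁻¹ := by
    refine mul_nonneg ?_ (inv_nonneg.mpr (hlog N hMN).le)
    rw [Finset.sum_sub_distrib, hbsum N hMN]; linarith [hasum N hMN]
  have hbf : ∑ n ∈ Finset.Ioc M N, b n * (Real.log n)⁻¹ ≤
      Real.log (Real.log N) - Real.log (Real.log M) := by
    clear hpart hnonneg
    induction N, hMN using Nat.le_induction with
    | base => simp
    | succ n hn ih =>
      rw [Finset.sum_Ioc_succ_top hn]
      have h1 := hlog n hn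
      have h2 := hlog (n + 1) (by omega)
      have h3 := Real.one_sub_inv_le_log_of_pos (div_pos h2 h1)
      rw [Real.log_div h2.ne' h1.ne', inv_div] at h3
      have h4 : b (n + 1) * (Real.log (n + 1 : ℕ))⁻¹ =
          1 - Real.log n / Real.log (n + 1 : ℕ) := by
        simp only [hb, Nat.add_sub_cancel]
        field_simp
      linarith
  have haf : ∑ p ∈ (Finset.Ioc M N).filter Nat.Prime, (p : ℝ)⁻¹ =
      ∑ n ∈ Finset.Ioc M N, a n * (Real.log n)⁻¹ := by
    rw [Finset.sum_filter]
    refine Finset.sum_congr rfl fun n hn => ?_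
    have h1 := hlog n (Finset.mem_Ioc.mp hn).1.le
    by_cases hp : n.Prime
    · simp only [ha, hp, if_true]; field_simp
    · simp [ha, hp]
  have hKM : K * (Real.log M)⁻¹ ≤ K * (Real.log 2)⁻¹ := by
    have : Real.log 2 ≤ Real.log M := Real.log_le_log (by norm_num) (by exact_mod_cast hM)
    have := Real.log_pos one_lt_two
    gcongr
  simp only [sub_mul, Finset.sum_sub_distrib] at hpart hnonneg
  rw [haf]
  linarith

theorem sum_pow_card_inter_le (P : Finset ℕ) {z : ℝ} (hz : 1 ≤ z)
    (N : ℕ) :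
    ∑ n ∈ Finset.Icc 1 N, z ^ (P ∩ n.primeFactors).card ≤
      N * Real.exp ((z - 1) * ∑ p ∈ P, (p : ℝ)⁻¹) := by
  have hz0 : 0 ≤ z - 1 := by linarith
  have hexpand : ∀ n ∈ Finset.Icc 1 N, z ^ (P ∩ n.primeFactors).card =
      ∑ t ∈ P.powerset, if t ⊆ n.primeFactors then (z - 1) ^ t.card else 0 := by
    intro n _
    have h := Finset.prod_one_add (f := fun _ : ℕ => z - 1) (P ∩ n.primeFactors)
    simp only [Finset.prod_const, add_sub_cancel] at h
    rw [h, ← Finset.sum_filter]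
    refine Finset.sum_congr ?_ fun _ _ => rfl
    ext t
    rw [Finset.mem_powerset, Finset.mem_filter, Finset.mem_powerset, Finset.subset_inter_iff]
  have hcount : ∀ t : Finset ℕ,
      (((Finset.Icc 1 N).filter fun n => t ⊆ n.primeFactors).card : ℝ) ≤ N * ∏ p ∈ t, (p : ℝ)⁻¹ := by
    intro t
    have hsub : ((Finset.Icc 1 N).filter fun n => t ⊆ n.primeFactors) ⊆
        (Finset.Ioc 0 N).filter fun n => (∏ p ∈ t, p) ∣ n := by
      intro n hn
      simp only [Finset.mem_filter, Finset.mem_Icc, Finset.mem_Ioc] at hn ⊢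
      exact ⟨⟨hn.1.1, hn.1.2⟩,
        (Finset.prod_dvd_prod_of_subset _ _ _ hn.2).trans (Nat.prod_primeFactors_dvd n)⟩
    have h1 := Finset.card_le_card hsub
    have h2 : ((Finset.Ioc 0 N).filter fun n => (∏ p ∈ t, p) ∣ n).card = N / ∏ p ∈ t, p := by
      rw [← Nat.Ioc_filter_dvd_card_eq_div]
    rw [h2] at h1
    calc _ ≤ ((N / ∏ p ∈ t, p : ℕ) : ℝ) := by exact_mod_cast h1
      _ ≤ (N : ℝ) / ((∏ p ∈ t, p : ℕ) : ℝ) := Nat.cast_div_le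
      _ = _ := by rw [Finset.prod_inv_distrib, div_eq_mul_inv]; push_cast; rfl
  rw [Finset.sum_congr rfl hexpand, Finset.sum_comm]
  calc _ = ∑ t ∈ P.powerset,
        (((Finset.Icc 1 N).filter fun n => t ⊆ n.primeFactors).card : ℝ) * (z - 1) ^ t.card := by
        refine Finset.sum_congr rfl fun t _ => ?_
        rw [← Finset.sum_filter, Finset.sum_const, nsmul_eq_mul]
    _ ≤ ∑ t ∈ P.powerset, (N * ∏ p ∈ t, (p : ℝ)⁻¹) * (z - 1) ^ t.card := by
        refine Finset.sum_le_sum fun t _ => ?_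
        have := hcount t
        gcongr
    _ = N * ∏ p ∈ P, (1 + (z - 1) * (p : ℝ)⁻¹) := by
        rw [Finset.prod_one_add, Finset.mul_sum]
        refine Finset.sum_congr rfl fun t _ => ?_
        rw [Finset.prod_mul_distrib, Finset.prod_const]
        ring
    _ ≤ _ := by
        rw [Finset.mul_sum, Real.exp_sum]
        gcongr with p hp
        rw [add_comm]
        exact Real.add_one_le_exp _

theorem le_card_filter_of_lt_log_pk {n k : ℕ} {L : ℝ} (hL : 0 ≤ L) (hk : 1 ≤ k)
    (h : L < Real.log (pk n k)) :
    k ≤ (n.primeFactors.filter fun p : ℕ => L < Real.log p).card := by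
  unfold pk at h
  split_ifs at h with hcard
  · set l := n.primeFactors.sort (· ≤ ·) with hl
    have hlen : l.length = n.primeFactors.card := Finset.length_sort _
    have hi : n.primeFactors.card - k < l.length := by omega
    rw [List.getD_eq_getElem _ _ hi] at h
    have hsub : (l.drop (n.primeFactors.card - k)).toFinset ⊆
        n.primeFactors.filter fun p : ℕ => L < Real.log p := by
      intro q hq
      rw [List.mem_toFinset, List.mem_iff_getElem] at hq
      obtain ⟨j, hj, rfl⟩ := hq
      rw [List.getElem_drop]
      rw [List.length_drop] at hj
      have hmem : ∀ m (hm : m < l.length), l[m] ∈ n.primeFactors := fun m hm =>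
        (Finset.mem_sort (· ≤ ·)).mp (List.getElem_mem hm)
      refine Finset.mem_filter.mpr ⟨hmem _ _, h.trans_le ?_⟩
      have hle : l[n.primeFactors.card - k] ≤ l[n.primeFactors.card - k + j] :=
        (Finset.sortedLT_sort n.primeFactors).sortedLE.getElem_le_getElem_of_le (by omega)
      exact Real.log_le_log
        (by exact_mod_cast (Nat.prime_of_mem_primeFactors (hmem _ _)).pos) (by exact_mod_cast hle)
    have hnd : (l.drop (n.primeFactors.card - k)).Nodup :=
      (Finset.sort_nodup _ _).sublist (List.drop_sublist _ _)
    have hc := Finset.card_le_card hsub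
    rw [List.toFinset_card_of_nodup hnd, List.length_drop] at hc
    omega
  · simp at h; linarith

theorem sum_inv_prime_lt_log_le : ∃ C : ℝ, ∀ (N : ℕ) (L : ℝ), 2 ≤ N → 0 < L →
    L ≤ Real.log (N + 1) →
    ∑ p ∈ (Finset.Ioc 0 N).filter (fun p : ℕ => p.Prime ∧ L < Real.log p), (p : ℝ)⁻¹ ≤
      Real.log (Real.log N) - Real.log L + C := by
  obtain ⟨C, hC0, hC⟩ := sum_inv_prime_Ioc_le
  refine ⟨C + Real.log 2 + 1 / 2, fun N L hN hL hLN => ?_⟩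
  set M := min N (max 2 ⌊Real.exp L⌋₊) with hM
  have hM2 : 2 ≤ M := by simp [hM, hN]
  have hMpos : (0 : ℝ) < M := by positivity
  have hexp : Real.exp L ≤ M + 1 := by
    rcases le_total N (max 2 ⌊Real.exp L⌋₊) with h | h
    · rw [hM, min_eq_left h]
      exact (Real.le_log_iff_exp_le (by positivity)).mp hLN
    · rw [hM, min_eq_right h]
      refine (Nat.lt_floor_add_one _).le.trans ?_
      gcongr
      exact le_max_right _ _
  have hM2' : (2 : ℝ) ≤ M := by exact_mod_cast hM2
  have hLM : L ≤ 2 * Real.log M := by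
    have h2 : Real.exp L ≤ (M : ℝ) ^ 2 := by nlinarith
    have h3 := (Real.le_log_iff_exp_le (by positivity)).mpr h2
    rwa [Real.log_pow] at h3
  have hlogM : 0 < Real.log M := Real.log_pos (by linarith)
  have hloglog : Real.log L ≤ Real.log 2 + Real.log (Real.log M) := by
    rw [← Real.log_mul (by norm_num) hlogM.ne']
    exact Real.log_le_log hL hLM
  have hsub : (Finset.Ioc 0 N).filter (fun p : ℕ => p.Prime ∧ L < Real.log p) ⊆
      insert 2 ((Finset.Ioc M N).filter Nat.Prime) := by
    intro p hp
    simp only [Finset.mem_filter, Finset.mem_Ioc, Finset.mem_insert] at hp ⊢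
    obtain ⟨⟨hp0, hpN⟩, hprime, hlp⟩ := hp
    rcases hprime.two_le.eq_or_lt with h | h
    · exact Or.inl h.symm
    · refine Or.inr ⟨⟨?_, hpN⟩, hprime⟩
      have hexp_lt : Real.exp L < p :=
        (Real.lt_log_iff_exp_lt (by exact_mod_cast hp0)).mp hlp
      have hfloor : ⌊Real.exp L⌋₊ < p := (Nat.floor_lt (Real.exp_pos L).le).mpr hexp_lt
      exact (min_le_right _ _).trans_lt (max_lt h hfloor)
  have hMN := hC M N hM2 (min_le_left _ _)
  calc _ ≤ ∑ p ∈ insert 2 ((Finset.Ioc M N).filter Nat.Prime), (p : ℝ)⁻¹ :=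
        Finset.sum_le_sum_of_subset_of_nonneg hsub fun _ _ _ => by positivity
    _ = 1 / 2 + ∑ p ∈ (Finset.Ioc M N).filter Nat.Prime, (p : ℝ)⁻¹ := by
        rw [Finset.sum_insert (by simp; omega)]
        norm_num
    _ ≤ _ := by linarith

/-- Number of `n ≤ x` having at least `k` prime factors `p` with `log p > γ ^ (-k) * log x`. -/
theorem card_many_large_primeFactors_le {γ : ℝ} (hγ1 : 1 < γ) (hγe : γ < Real.exp 1) :
    ∃ D r : ℝ, 0 < D ∧ 0 < r ∧ r < 1 ∧ ∀ x : ℝ, 2 ≤ x → ∀ k : ℕ,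
      (((Finset.Icc 1 ⌊x⌋₊).filter fun n => k ≤ (n.primeFactors.filter fun p : ℕ =>
        γ ^ (-(k : ℤ)) * Real.log x < Real.log p).card).card : ℝ) ≤ D * r ^ k * x := by
  obtain ⟨C, hC⟩ := sum_inv_prime_lt_log_le
  set l := Real.log γ with hl
  have hl0 : 0 < l := Real.log_pos hγ1
  have hl1 : l < 1 := (Real.log_lt_iff_lt_exp (by linarith)).mpr hγe
  refine ⟨Real.exp ((l⁻¹ - 1) * C), l * Real.exp (1 - l), Real.exp_pos _, by positivity, ?_,
    fun x hx k => ?_⟩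
  · have h := Real.add_one_lt_exp (x := l - 1) (by linarith)
    rw [← neg_sub l 1, Real.exp_neg, ← div_eq_mul_inv, div_lt_one (Real.exp_pos _)]
    linarith
  set N := ⌊x⌋₊ with hN
  set L := γ ^ (-(k : ℤ)) * Real.log x with hL
  set P := (Finset.Ioc 0 N).filter fun p : ℕ => p.Prime ∧ L < Real.log p with hP
  have hz : 1 ≤ l⁻¹ := (one_le_inv₀ hl0).mpr hl1.le
  have hlogx : 0 < Real.log x := Real.log_pos (by linarith)
  have hγ0 : 0 < γ := by linarith
  have hL0 : 0 < L := by positivity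
  have hN2 : 2 ≤ N := Nat.le_floor (by exact_mod_cast hx)
  have hNx : (N : ℝ) ≤ x := Nat.floor_le (by linarith)
  have hN2' : (2 : ℝ) ≤ N := by exact_mod_cast hN2
  have hLx : L ≤ Real.log (N + 1) := by
    have h1 : γ ^ (-(k : ℤ)) ≤ 1 := zpow_le_one_of_nonpos₀ hγ1.le (by simp)
    have h2 : Real.log x ≤ Real.log (N + 1) :=
      Real.log_le_log (by linarith) (Nat.lt_floor_add_one x).le
    exact (mul_le_of_le_one_left hlogx.le h1).trans h2
  have hlogL : Real.log L = Real.log (Real.log x) - k * l := by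
    rw [hL, Real.log_mul (by positivity) hlogx.ne', Real.log_zpow]
    push_cast
    ring
  have hloglog : Real.log (Real.log N) ≤ Real.log (Real.log x) :=
    Real.log_le_log (Real.log_pos (by linarith)) (Real.log_le_log (by linarith) hNx)
  have hS : ∑ p ∈ P, (p : ℝ)⁻¹ ≤ k * l + C := by
    linarith [hC N L hN2 hL0 hLx]
  set S := (Finset.Icc 1 N).filter fun n =>
    k ≤ (n.primeFactors.filter fun p : ℕ => L < Real.log p).card with hSdef
  have hmarkov : (S.card : ℝ) * l⁻¹ ^ k ≤ ∑ n ∈ Finset.Icc 1 N, l⁻¹ ^ (P ∩ n.primeFactors).card := by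
    rw [← nsmul_eq_mul, ← Finset.sum_const]
    refine (Finset.sum_le_sum fun n hn => ?_).trans
      (Finset.sum_le_sum_of_subset_of_nonneg (Finset.filter_subset _ _) fun _ _ _ => by positivity)
    rw [hSdef, Finset.mem_filter, Finset.mem_Icc] at hn
    refine pow_le_pow_right₀ hz (hn.2.trans (Finset.card_le_card fun p hp => ?_))
    rw [Finset.mem_filter] at hp
    have hprime := Nat.prime_of_mem_primeFactors hp.1
    simp only [hP, Finset.mem_inter, Finset.mem_filter, Finset.mem_Ioc]
    exact ⟨⟨⟨hprime.pos, (Nat.le_of_mem_primeFactors hp.1).trans hn.1.2⟩, hprime, hp.2⟩, hp.1⟩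
  have hmoment := sum_pow_card_inter_le P hz N
  have hexp : Real.exp ((l⁻¹ - 1) * ∑ p ∈ P, (p : ℝ)⁻¹) ≤
      Real.exp ((l⁻¹ - 1) * C) * Real.exp (1 - l) ^ k := by
    rw [← Real.exp_nat_mul, ← Real.exp_add]
    refine Real.exp_le_exp.mpr ((mul_le_mul_of_nonneg_left hS (by linarith)).trans_eq ?_)
    field_simp
    ring
  have hcard : (S.card : ℝ) * l⁻¹ ^ k ≤
      x * (Real.exp ((l⁻¹ - 1) * C) * Real.exp (1 - l) ^ k) :=
    (hmarkov.trans hmoment).trans (mul_le_mul hNx hexp (Real.exp_pos _).le (by linarith))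
  rw [inv_pow, ← div_eq_mul_inv, div_le_iff₀ (by positivity)] at hcard
  rw [mul_pow]
  linarith

/-- For 2 < γ < e and ε > 0 there is k₀ such that for all sufficiently
large x, #{n ≤ x : log p_k(n) > γ^{-k} log x for some k ≥ k₀} ≤ 2εx. -/
theorem count_some_large_prime_factor (γ : ℝ) (hγ2 : 2 < γ) (hγe : γ < Real.exp 1)
    (ε : ℝ) (hε : 0 < ε) :
    ∃ k₀ : ℝ, ∀ᶠ x : ℝ in atTop,
      (((Finset.Icc 1 ⌊x⌋₊).filter
          (fun n => ∃ k : ℕ, 1 ≤ k ∧ k₀ ≤ (k : ℝ) ∧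
            Real.log (pk n k) > γ ^ (-(k : ℤ)) * Real.log x)).card : ℝ)
        ≤ 2 * ε * x := by
  obtain ⟨D, r, hD, hr0, hr1, hbound⟩ := card_many_large_primeFactors_le (by linarith) hγe
  obtain ⟨K, hK⟩ := exists_pow_lt_of_lt_one (x := 2 * ε * (1 - r) / D)
    (div_pos (mul_pos (by linarith) (by linarith)) hD) hr1
  refine ⟨K, ?_⟩
  filter_upwards [eventually_ge_atTop 2] with x hx
  have hlogx : 0 < Real.log x := Real.log_pos (by linarith)
  have hγ0 : 0 < γ := by linarith
  set T : ℕ → Finset ℕ := fun k => (Finset.Icc 1 ⌊x⌋₊).filter fun n =>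
    k ≤ (n.primeFactors.filter fun p : ℕ => γ ^ (-(k : ℤ)) * Real.log x < Real.log p).card with hT
  have hsub : ((Finset.Icc 1 ⌊x⌋₊).filter (fun n => ∃ k : ℕ, 1 ≤ k ∧ (K : ℝ) ≤ (k : ℝ) ∧
      Real.log (pk n k) > γ ^ (-(k : ℤ)) * Real.log x)) ⊆
      (Finset.Ico K (⌊x⌋₊ + 1)).biUnion T := by
    intro n hn
    rw [Finset.mem_filter] at hn
    obtain ⟨hn, k, hk1, hKk, hlog⟩ := hn
    have hcard := le_card_filter_of_lt_log_pk (by positivity) hk1 hlog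
    have hkn : k ≤ n := hcard.trans ((Finset.card_filter_le _ _).trans
      ((Finset.card_le_card fun p hp => Finset.mem_Icc.mpr
        ⟨(Nat.prime_of_mem_primeFactors hp).pos, Nat.le_of_mem_primeFactors hp⟩).trans_eq
        (Nat.card_Icc 1 n)))
    have hnx := (Finset.mem_Icc.mp hn).2
    rw [Finset.mem_biUnion]
    exact ⟨k, Finset.mem_Ico.mpr ⟨by exact_mod_cast hKk, by omega⟩,
      Finset.mem_filter.mpr ⟨hn, hcard⟩⟩
  have hgeom : ∑ k ∈ Finset.Ico K (⌊x⌋₊ + 1), r ^ k ≤ r ^ K / (1 - r) :=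
    geom_sum_Ico_le_of_lt_one hr0.le hr1
  calc _ ≤ (((Finset.Ico K (⌊x⌋₊ + 1)).biUnion T).card : ℝ) := by
        exact_mod_cast Finset.card_le_card hsub
    _ ≤ ∑ k ∈ Finset.Ico K (⌊x⌋₊ + 1), ((T k).card : ℝ) := by
        exact_mod_cast Finset.card_biUnion_le
    _ ≤ ∑ k ∈ Finset.Ico K (⌊x⌋₊ + 1), D * r ^ k * x :=
        Finset.sum_le_sum fun k _ => hbound x hx k
    _ = D * (∑ k ∈ Finset.Ico K (⌊x⌋₊ + 1), r ^ k) * x := by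
        rw [Finset.mul_sum, Finset.sum_mul]
    _ ≤ 2 * ε * x := by
        refine mul_le_mul_of_nonneg_right ?_ (by linarith)
        rw [lt_div_iff₀ hD] at hK
        calc _ ≤ D * (r ^ K / (1 - r)) := by gcongr
          _ = r ^ K * D / (1 - r) := by ring
          _ ≤ 2 * ε := (div_le_iff₀ (by linarith)).mpr hK.le
end

section
/- For every integer n > 1, B(n) ≤ n^{τ(n)} · ∏_{d ∣ n} A(d), where the product is over all positive divisors d of n. -/
open Polynomial Filter
open scoped Classical

theorem natAbs_coeff_le_polyHeight (f : ℤ[X]) (i : ℕ) : (f.coeff i).natAbs ≤ polyHeight f := by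
  by_cases h : i ∈ f.support
  · exact Finset.le_sup (f := fun i => (f.coeff i).natAbs) h
  · simp [notMem_support_iff.mp h]

theorem polyHeight_le_iff {f : ℤ[X]} {m : ℕ} :
    polyHeight f ≤ m ↔ ∀ i, (f.coeff i).natAbs ≤ m :=
  ⟨fun h i => (natAbs_coeff_le_polyHeight f i).trans h, fun h => Finset.sup_le fun i _ => h i⟩

theorem polyHeight_mul_le (f g : ℤ[X]) :
    polyHeight (f * g) ≤ (f.natDegree + 1) * (polyHeight f * polyHeight g) := by
  refine polyHeight_le_iff.mpr fun k => ?_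
  conv_lhs => rw [f.as_sum_range_C_mul_X_pow, Finset.sum_mul, finsetSum_coeff]
  refine (Int.natAbs_sum_le _ _).trans ?_
  conv_rhs => rw [← smul_eq_mul, ← Finset.card_range (f.natDegree + 1)]
  refine Finset.sum_le_card_nsmul (N := ℕ) _ _ _ fun i _ => ?_
  rw [mul_assoc, coeff_C_mul, Int.natAbs_mul, coeff_X_pow_mul']
  gcongr
  · exact natAbs_coeff_le_polyHeight f i
  · split_ifs
    · exact natAbs_coeff_le_polyHeight g _
    · simp

theorem polyHeight_neg (f : ℤ[X]) : polyHeight (-f) = polyHeight f := by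
  simp [polyHeight]

theorem Associated.polyHeight_eq {f g : ℤ[X]} (h : Associated f g) :
    polyHeight f = polyHeight g := by
  obtain ⟨u, rfl⟩ := h
  obtain ⟨r, hr, hu⟩ := Polynomial.isUnit_iff.mp u.isUnit
  rcases Int.isUnit_iff.mp hr with rfl | rfl <;> simp [← hu, polyHeight_neg]

theorem one_le_A (d : ℕ) : 1 ≤ A d := by
  simpa [A, coeff_natDegree, (cyclotomic.monic d ℤ).leadingCoeff] using
    natAbs_coeff_le_polyHeight (cyclotomic d ℤ) (cyclotomic d ℤ).natDegree

theorem polyHeight_one : polyHeight 1 = 1 :=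
  le_antisymm (polyHeight_le_iff.mpr fun i => by rw [coeff_one]; split_ifs <;> simp)
    (by simpa using natAbs_coeff_le_polyHeight 1 0)

theorem polyHeight_le_A_of_dvd_cyclotomic {d : ℕ} (hd : 0 < d) {f : ℤ[X]}
    (hf : f ∣ cyclotomic d ℤ) : polyHeight f ≤ A d := by
  rcases (cyclotomic.irreducible hd).dvd_iff.mp hf with h | h
  · rw [(associated_one_iff_isUnit.mpr h).polyHeight_eq, polyHeight_one]
    exact one_le_A d
  · exact h.symm.polyHeight_eq.le

theorem polyHeight_le_prod_of_dvd_prod_cyclotomic (S : Finset ℕ) (hS : ∀ d ∈ S, 0 < d)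
    {f : ℤ[X]} (hf : f ∣ ∏ d ∈ S, cyclotomic d ℤ) :
    polyHeight f ≤ ∏ d ∈ S, (d.totient + 1) * A d := by
  induction S using Finset.induction_on generalizing f with
  | empty =>
    rw [Finset.prod_empty] at hf ⊢
    rw [(associated_one_iff_isUnit.mpr (isUnit_of_dvd_one hf)).polyHeight_eq, polyHeight_one]
  | insert a S ha ih =>
    rw [Finset.prod_insert ha] at hf ⊢
    obtain ⟨g, h, hg, hh, rfl⟩ := exists_dvd_and_dvd_of_dvd_mul hf
    have hdeg : g.natDegree ≤ a.totient :=
      natDegree_cyclotomic a ℤ ▸ natDegree_le_of_dvd hg (cyclotomic_ne_zero a ℤ)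
    refine (polyHeight_mul_le g h).trans ?_
    rw [← mul_assoc]
    gcongr
    · exact polyHeight_le_A_of_dvd_cyclotomic (hS a (Finset.mem_insert_self a S)) hg
    · exact ih (fun d hd => hS d (Finset.mem_insert_of_mem hd)) hh

/-- For n > 1, B(n) ≤ n^{τ(n)} · ∏_{d ∣ n} A(d). -/
theorem B_le_pow_tau_mul_prod_A (n : ℕ) (hn : 1 < n) :
    B n ≤ n ^ tau n * ∏ d ∈ n.divisors, A d := by
  refine csSup_le' ?_
  rintro _ ⟨f, hf, rfl⟩
  rw [← prod_cyclotomic_eq_X_pow_sub_one (zero_lt_one.trans hn)] at hf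
  refine (polyHeight_le_prod_of_dvd_prod_cyclotomic _
    (fun d hd => Nat.pos_of_mem_divisors hd) hf).trans ?_
  rw [tau, ← Finset.prod_const, ← Finset.prod_mul_distrib]
  refine Finset.prod_le_prod' fun d hd => Nat.mul_le_mul_right _ ?_
  have hle := Nat.divisor_le hd
  rcases (Nat.succ_le_of_lt (Nat.pos_of_mem_divisors hd)).eq_or_lt with rfl | h
  · simpa using Nat.succ_le_of_lt hn
  · exact (Nat.totient_lt d h).trans_le hle
end

section
/- Let b > 1 be a real number. There exists a constant C > 0 (depending only on b) such that for all real numbers x > 1 and t with 1 < t ≤ x, ∑_{n ≤ x} b^{ω([t,x], n)} ≤ C · x · ((log x)/(log t))^{b−1}, where the sum is over positive integers n ≤ x. -/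
open Polynomial Filter
open scoped Classical

open ArithmeticFunction in
theorem log_factorial_eq_sum_vonMangoldt_mul_div (N : ℕ) :
    Real.log (N.factorial) = ∑ n ∈ Finset.Ioc 0 N, vonMangoldt n * ((N / n : ℕ) : ℝ) := by
  rw [← sum_Ioc_mul_zeta_eq_sum, vonMangoldt_mul_zeta]
  induction N with
  | zero => simp
  | succ n ih =>
    rw [Finset.sum_Ioc_succ_top n.zero_le, ← ih, Nat.factorial_succ, Nat.cast_mul,
      Real.log_mul (by positivity) (by positivity), log_apply]
    ring

open ArithmeticFunction in
/-- Lower half of Mertens' first theorem. -/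
theorem log_sub_one_le_sum_vonMangoldt_div {N : ℕ} (hN : N ≠ 0) :
    Real.log N - 1 ≤ ∑ n ∈ Finset.Ioc 0 N, vonMangoldt n / n := by
  have hNpos : (0 : ℝ) < N := by positivity
  refine le_of_mul_le_mul_left ?_ hNpos
  calc (N : ℝ) * (Real.log N - 1) ≤ Real.log N.factorial := by
        have h := Stirling.le_log_factorial_stirling hN
        have h1 : 0 ≤ Real.log N := Real.log_natCast_nonneg N
        have h2 : 0 ≤ Real.log (2 * Real.pi) := Real.log_nonneg (by linarith [Real.pi_gt_three])
        linarith
    _ ≤ N * ∑ n ∈ Finset.Ioc 0 N, vonMangoldt n / n := by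
        rw [log_factorial_eq_sum_vonMangoldt_mul_div, Finset.mul_sum]
        refine Finset.sum_le_sum fun n _ => ?_
        calc vonMangoldt n * ((N / n : ℕ) : ℝ) ≤ vonMangoldt n * (N / n) :=
              mul_le_mul_of_nonneg_left Nat.cast_div_le vonMangoldt_nonneg
          _ = N * (vonMangoldt n / n) := by ring

open ArithmeticFunction in
/-- Upper half of Mertens' first theorem. -/
theorem sum_vonMangoldt_div_le (N : ℕ) :
    ∑ n ∈ Finset.Ioc 0 N, vonMangoldt n / n ≤ Real.log N + (Real.log 4 + 4) := by
  rcases N.eq_zero_or_pos with rfl | hN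
  · simp; positivity
  have hNpos : (0 : ℝ) < N := by positivity
  refine le_of_mul_le_mul_left ?_ hNpos
  calc N * ∑ n ∈ Finset.Ioc 0 N, vonMangoldt n / n
      ≤ ∑ n ∈ Finset.Ioc 0 N, (vonMangoldt n * ((N / n : ℕ) : ℝ) + vonMangoldt n) := by
        rw [Finset.mul_sum]
        refine Finset.sum_le_sum fun n _ => ?_
        calc N * (vonMangoldt n / n) = vonMangoldt n * ((N : ℝ) / n) := by ring
          _ ≤ vonMangoldt n * (((N / n : ℕ) : ℝ) + 1) := by
              refine mul_le_mul_of_nonneg_left ?_ vonMangoldt_nonneg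
              rw [← Nat.floor_div_eq_div (K := ℝ)]
              exact (Nat.lt_floor_add_one _).le
          _ = _ := by ring
    _ = Real.log N.factorial + Chebyshev.psi N := by
        rw [Finset.sum_add_distrib, ← log_factorial_eq_sum_vonMangoldt_mul_div, Chebyshev.psi,
          Nat.floor_natCast]
    _ ≤ N * Real.log N + (Real.log 4 + 4) * N := by
        refine add_le_add ?_ (Chebyshev.psi_le_const_mul_self hNpos.le)
        rw [← Real.log_pow]
        exact Real.log_le_log (by positivity) (mod_cast Nat.factorial_le_pow N)
    _ = _ := by ring

theorem one_sub_log_div_log_le {u v : ℝ} (hu : 1 < u) (hv : 1 < v) :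
    1 - Real.log u / Real.log v ≤ Real.log (Real.log v) - Real.log (Real.log u) := by
  have hlu := Real.log_pos hu
  have hlv := Real.log_pos hv
  have h := Real.log_le_sub_one_of_pos (div_pos hlu hlv)
  rw [Real.log_div hlu.ne' hlv.ne'] at h
  linarith

open ArithmeticFunction in
/-- Partial summation of Mertens' first theorem against `1 / log`. -/
theorem sum_vonMangoldt_div_mul_log_le_of_abel {m N : ℕ} (hm : 2 ≤ m) (hmN : m ≤ N) :
    ∑ n ∈ Finset.Icc m N, vonMangoldt n / (n * Real.log n) ≤
      Real.log (Real.log N) - Real.log (Real.log m) +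
        (∑ n ∈ Finset.Ioc 0 N, vonMangoldt n / n - Real.log N) / Real.log N +
        (Real.log 4 + 4) * ((Real.log m)⁻¹ - (Real.log N)⁻¹) + (1 + (Real.log m)⁻¹) := by
  have hlog {k : ℕ} (hk : m ≤ k) : 0 < Real.log k :=
    Real.log_pos (by exact_mod_cast (by omega : 1 < k))
  induction N, hmN using Nat.le_induction with
  | base =>
    have h0 := hlog le_rfl
    have hm1 : (1 : ℝ) ≤ m := by exact_mod_cast (by omega : 1 ≤ m)
    have h1 : vonMangoldt m / (m * Real.log m) ≤ 1 := by
      rw [div_le_one (by positivity)]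
      exact vonMangoldt_le_log.trans (le_mul_of_one_le_left h0.le hm1)
    have h2 : -(Real.log m)⁻¹ ≤
        (∑ n ∈ Finset.Ioc 0 m, vonMangoldt n / n - Real.log m) / Real.log m := by
      rw [inv_eq_one_div, ← neg_div]
      gcongr
      linarith [log_sub_one_le_sum_vonMangoldt_div (N := m) (by omega)]
    simp only [Finset.Icc_self, Finset.sum_singleton, sub_self, mul_zero]
    linarith
  | succ n hn ih =>
    have h0 := hlog hn
    have h1 := hlog (hn.trans n.le_succ)
    have hn1 : (1 : ℝ) < n := by exact_mod_cast (by omega : 1 < n)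
    have hn2 : (1 : ℝ) < (n + 1 : ℕ) := by exact_mod_cast (by omega : 1 < n + 1)
    have hg : (Real.log (n + 1 : ℕ))⁻¹ ≤ (Real.log n)⁻¹ := by
      gcongr
      omega
    have hll := one_sub_log_div_log_le hn1 hn2
    have hM := mul_nonneg (sub_nonneg.2 (sum_vonMangoldt_div_le n)) (sub_nonneg.2 hg)
    rw [← Finset.insert_Icc_right_eq_Icc_add_one (by omega), Finset.sum_insert (by simp),
      Finset.sum_Ioc_succ_top n.zero_le]
    have e1 : ∀ a : ℝ, (a - Real.log (n + 1 : ℕ)) / Real.log (n + 1 : ℕ) =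
        a * (Real.log (n + 1 : ℕ))⁻¹ - 1 := fun a => by field_simp
    have e2 : ∀ a : ℝ, (a - Real.log n) / Real.log n =
        a * (Real.log n)⁻¹ - 1 := fun a => by field_simp
    have e3 : vonMangoldt (n + 1) / ((n + 1 : ℕ) * Real.log (n + 1 : ℕ)) =
        vonMangoldt (n + 1) / (n + 1 : ℕ) * (Real.log (n + 1 : ℕ))⁻¹ := by field_simp
    have e4 : Real.log n * (Real.log n)⁻¹ = 1 := mul_inv_cancel₀ h0.ne'
    rw [e1, e3]
    rw [e2] at ih
    rw [div_eq_mul_inv] at hll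
    nlinarith

/-- Upper bound in Mertens' second theorem for the primes of an interval. -/
theorem exists_sum_inv_primes_Icc_le :
    ∃ C : ℝ, ∀ x t : ℝ, 1 < t → t ≤ x →
      ∑ p ∈ (Finset.Icc ⌈t⌉₊ ⌊x⌋₊).filter Nat.Prime, (p : ℝ)⁻¹ ≤
        Real.log (Real.log x / Real.log t) + C := by
  refine ⟨(Real.log 4 + 4) * (Real.log 2)⁻¹ + (1 + (Real.log 2)⁻¹), fun x t ht htx => ?_⟩
  have hlt := Real.log_pos ht
  have hlx := Real.log_pos (ht.trans_le htx)
  have hl2 := Real.log_pos (one_lt_two (α := ℝ))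
  have hl4 := Real.log_nonneg (show (1 : ℝ) ≤ 4 by norm_num)
  rcases lt_or_ge ⌊x⌋₊ ⌈t⌉₊ with h | h
  · rw [Finset.Icc_eq_empty (not_le.2 h), Finset.filter_empty, Finset.sum_empty]
    have : 0 ≤ Real.log (Real.log x / Real.log t) :=
      Real.log_nonneg ((one_le_div hlt).2 (Real.log_le_log (by linarith) htx))
    positivity
  set m := ⌈t⌉₊
  set N := ⌊x⌋₊
  have hm : 2 ≤ m := Nat.lt_ceil.2 (by exact_mod_cast ht)
  have hm2 : (2 : ℝ) ≤ m := by exact_mod_cast hm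
  have hN2 : (m : ℝ) ≤ N := by exact_mod_cast h
  have hlN : 0 < Real.log N := Real.log_pos (by linarith)
  have hNx : (N : ℝ) ≤ x := Nat.floor_le (by linarith)
  have hsum : ∑ p ∈ (Finset.Icc m N).filter Nat.Prime, (p : ℝ)⁻¹ ≤
      ∑ n ∈ Finset.Icc m N, ArithmeticFunction.vonMangoldt n / (n * Real.log n) := by
    rw [Finset.sum_filter]
    refine Finset.sum_le_sum fun n hn => ?_
    split_ifs with hp
    · have := Real.log_pos (show (1 : ℝ) < n by exact_mod_cast hp.one_lt)
      rw [ArithmeticFunction.vonMangoldt_apply_prime hp]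
      apply le_of_eq
      field_simp
    · exact div_nonneg ArithmeticFunction.vonMangoldt_nonneg
        (mul_nonneg n.cast_nonneg (Real.log_natCast_nonneg n))
  have hmain := sum_vonMangoldt_div_mul_log_le_of_abel hm h
  have hr : (∑ n ∈ Finset.Ioc 0 N, ArithmeticFunction.vonMangoldt n / n - Real.log N) /
      Real.log N ≤ (Real.log 4 + 4) * (Real.log N)⁻¹ := by
    rw [← div_eq_mul_inv]
    gcongr
    linarith [sum_vonMangoldt_div_le N]
  have hm3 : (Real.log m)⁻¹ ≤ (Real.log 2)⁻¹ := by gcongr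
  have hm4 : (Real.log 4 + 4) * (Real.log m)⁻¹ ≤ (Real.log 4 + 4) * (Real.log 2)⁻¹ := by gcongr
  have hx1 : Real.log (Real.log N) ≤ Real.log (Real.log x) := by gcongr; linarith
  have ht1 : Real.log (Real.log t) ≤ Real.log (Real.log m) := by
    gcongr
    exact Nat.le_ceil t
  rw [Real.log_div hlx.ne' hlt.ne']
  linarith

/-- Expanding `b ^ ω = ∑ (b - 1) ^ |S|` over sets `S` of prime divisors and counting multiples. -/
theorem sum_pow_card_filter_dvd_le {b : ℝ} (hb : 1 ≤ b) (N : ℕ) {P : Finset ℕ}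
    (hP : ∀ p ∈ P, p.Prime) :
    ∑ n ∈ Finset.Ioc 0 N, b ^ (P.filter (· ∣ n)).card ≤
      N * ∏ p ∈ P, (1 + (b - 1) * (p : ℝ)⁻¹) := by
  have hdvd (S : Finset ℕ) (hS : S ∈ P.powerset) (n : ℕ) :
      S ∈ (P.filter (· ∣ n)).powerset ↔ ∏ p ∈ S, p ∣ n := by
    rw [Finset.mem_powerset] at hS ⊢
    refine ⟨fun h => Finset.prod_primes_dvd n (fun p hp => (hP p (hS hp)).prime)
      fun p hp => (Finset.mem_filter.1 (h hp)).2, fun h p hp => ?_⟩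
    exact Finset.mem_filter.2 ⟨hS hp, (Finset.dvd_prod_of_mem _ hp).trans h⟩
  have hexp (n : ℕ) : b ^ (P.filter (· ∣ n)).card =
      ∑ S ∈ P.powerset, if ∏ p ∈ S, p ∣ n then (b - 1) ^ S.card else 0 := by
    rw [← Finset.sum_filter]
    have h := Finset.prod_one_add (f := fun _ : ℕ => b - 1) (P.filter (· ∣ n))
    simp only [add_sub_cancel, Finset.prod_const] at h
    rw [h]
    refine Finset.sum_congr (Finset.ext fun S => ?_) fun _ _ => rfl
    rw [Finset.mem_filter]
    refine ⟨fun hS => ?_, fun hS => (hdvd S hS.1 n).2 hS.2⟩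
    have hS' := Finset.powerset_mono.2 (Finset.filter_subset _ P) hS
    exact ⟨hS', (hdvd S hS' n).1 hS⟩
  simp only [hexp]
  rw [Finset.sum_comm, Finset.prod_one_add, Finset.mul_sum]
  refine Finset.sum_le_sum fun S _ => ?_
  rw [← Finset.sum_filter, Finset.sum_const, Nat.Ioc_filter_dvd_card_eq_div, nsmul_eq_mul,
    Finset.prod_mul_distrib, Finset.prod_const, Finset.prod_inv_distrib, ← Nat.cast_prod]
  calc ((N / ∏ p ∈ S, p : ℕ) : ℝ) * (b - 1) ^ S.card
      ≤ N / (∏ p ∈ S, p : ℕ) * (b - 1) ^ S.card :=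
        mul_le_mul_of_nonneg_right Nat.cast_div_le (pow_nonneg (by linarith) _)
    _ = _ := by ring

theorem omegaInterval_eq_card_filter_dvd {t x : ℝ} (hx : 0 ≤ x) {n : ℕ} (hn : n ≠ 0) :
    omegaInterval t x n =
      (((Finset.Icc ⌈t⌉₊ ⌊x⌋₊).filter Nat.Prime).filter (· ∣ n)).card := by
  unfold omegaInterval
  congr 1
  ext p
  simp only [Finset.mem_filter, Finset.mem_Icc, Nat.mem_primeFactors, Nat.ceil_le,
    Nat.le_floor_iff hx]
  tauto

/-- For b > 1 there is C > 0 with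
∑_{n ≤ x} b^{ω([t,x],n)} ≤ C x (log x / log t)^{b-1} for all 1 < t ≤ x. -/
theorem sum_pow_omegaInterval_le (b : ℝ) (hb : 1 < b) :
    ∃ C : ℝ, 0 < C ∧ ∀ x t : ℝ, 1 < x → 1 < t → t ≤ x →
      ∑ n ∈ Finset.Icc 1 ⌊x⌋₊, b ^ omegaInterval t x n ≤
        C * x * (Real.log x / Real.log t) ^ (b - 1) := by
  obtain ⟨C, hC⟩ := exists_sum_inv_primes_Icc_le
  refine ⟨Real.exp ((b - 1) * C), Real.exp_pos _, fun x t hx ht htx => ?_⟩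
  set P := (Finset.Icc ⌈t⌉₊ ⌊x⌋₊).filter Nat.Prime
  have hx0 : 0 ≤ x := by linarith
  have hb0 : 0 ≤ b - 1 := by linarith
  calc ∑ n ∈ Finset.Icc 1 ⌊x⌋₊, b ^ omegaInterval t x n
      = ∑ n ∈ Finset.Ioc 0 ⌊x⌋₊, b ^ (P.filter (· ∣ n)).card := by
        refine Finset.sum_congr rfl fun n hn => ?_
        rw [omegaInterval_eq_card_filter_dvd hx0 (by grind)]
    _ ≤ ⌊x⌋₊ * ∏ p ∈ P, (1 + (b - 1) * (p : ℝ)⁻¹) :=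
        sum_pow_card_filter_dvd_le hb.le _ fun p hp => (Finset.mem_filter.1 hp).2
    _ ≤ x * ∏ p ∈ P, Real.exp ((b - 1) * (p : ℝ)⁻¹) := by
        refine mul_le_mul (Nat.floor_le hx0) (Finset.prod_le_prod (fun p _ => by positivity)
          fun p _ => ?_) (Finset.prod_nonneg fun p _ => by positivity) hx0
        rw [add_comm]
        exact Real.add_one_le_exp _
    _ ≤ x * Real.exp ((b - 1) * (Real.log (Real.log x / Real.log t) + C)) := by
        rw [← Real.exp_sum, ← Finset.mul_sum]
        gcongr
        exact hC x t ht htx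
    _ = Real.exp ((b - 1) * C) * x * (Real.log x / Real.log t) ^ (b - 1) := by
        rw [Real.rpow_def_of_pos (div_pos (Real.log_pos hx) (Real.log_pos ht)), mul_add,
          Real.exp_add, mul_comm (b - 1) (Real.log _)]
        ring
end

section
/- Let b > 1 and ε > 0 be real numbers. There exists a constant C > 0 (depending only on b and ε) such that for all real numbers x > 1 and t with 1 < t < x, the number of positive integers n ≤ x satisfying ω([t,x], n) > ((1+ε)(b−1)/log b) · (log log x − log log t) is at most C · x · ((log x)/(log t))^{−ε(b−1)}. -/
open Polynomial Filter
open scoped Classical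

/-- Expansion of `log n!` over the primes up to `n`. -/
lemma log_factorial_eq_sum_primesLE (n : ℕ) :
    Real.log n.factorial =
      ∑ p ∈ Nat.primesLE n, (n.factorial.factorization p : ℝ) * Real.log p := by
  rw [Real.log_nat_eq_sum_factorization, Finsupp.sum]
  refine Finset.sum_subset (fun p hp => ?_) (fun p _ hp => ?_)
  · have hp' := Nat.support_factorization n.factorial ▸ hp
    have hprime := Nat.prime_of_mem_primeFactors hp'
    exact Nat.mem_primesLE.2
      ⟨hprime.dvd_factorial.1 (Nat.dvd_of_mem_primeFactors hp'), hprime⟩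
  · simp [Finsupp.notMem_support_iff.1 hp]

/-- Upper half of Mertens' first theorem. -/
lemma sum_primesLE_log_div_le {n : ℕ} (hn : 1 ≤ n) :
    ∑ p ∈ Nat.primesLE n, Real.log p / p ≤ Real.log n + Real.log 4 := by
  have hn' : (0 : ℝ) < n := by exact_mod_cast hn
  have hfact : Real.log n.factorial ≤ n * Real.log n := by
    rw [← Real.log_pow]
    exact Real.log_le_log (by positivity) (by exact_mod_cast Nat.factorial_le_pow n)
  have htheta : ∑ p ∈ Nat.primesLE n, Real.log p ≤ Real.log 4 * n := by
    rw [← Chebyshev.theta_eq_sum_primesLE_log]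
    exact Chebyshev.theta_le_log4_mul_x hn'.le
  have hlower : n * ∑ p ∈ Nat.primesLE n, Real.log p / p - ∑ p ∈ Nat.primesLE n, Real.log p ≤
      Real.log n.factorial := by
    rw [log_factorial_eq_sum_primesLE, Finset.mul_sum, ← Finset.sum_sub_distrib]
    refine Finset.sum_le_sum fun p hp => ?_
    have hprime := Nat.prime_of_mem_primesLE hp
    have hdiv : n / p ≤ n.factorial.factorization p := by
      have hmono := (Nat.factorization_le_iff_dvd (Nat.factorial_ne_zero _)
        (Nat.factorial_ne_zero _)).2 (Nat.factorial_dvd_factorial (Nat.mul_div_le n p)) p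
      rw [Nat.factorization_factorial_mul hprime] at hmono
      omega
    have hdiv' : (n : ℝ) / p - 1 ≤ n.factorial.factorization p := by
      have hfloor := Nat.lt_floor_add_one ((n : ℝ) / p)
      rw [Nat.floor_div_eq_div] at hfloor
      have : ((n / p : ℕ) : ℝ) ≤ n.factorial.factorization p := by exact_mod_cast hdiv
      linarith
    calc (n : ℝ) * (Real.log p / p) - Real.log p = (n / p - 1) * Real.log p := by ring
      _ ≤ _ := mul_le_mul_of_nonneg_right hdiv' (Real.log_natCast_nonneg p)
  refine le_of_mul_le_mul_left ?_ hn'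
  linarith

/-- Lower half of Mertens' first theorem. -/
lemma exists_log_sub_le_sum_primesLE_log_div :
    ∃ K : ℝ, ∀ n : ℕ, 1 ≤ n → Real.log n - K ≤ ∑ p ∈ Nat.primesLE n, Real.log p / p := by
  have hsum : Summable fun k : ℕ => 4 * (1 / (k : ℝ) ^ (3 / 2 : ℝ)) :=
    (Real.summable_one_div_nat_rpow.2 (by norm_num)).mul_left 4
  refine ⟨1 + ∑' k : ℕ, 4 * (1 / (k : ℝ) ^ (3 / 2 : ℝ)), fun n hn => ?_⟩
  have hn' : (0 : ℝ) < n := by exact_mod_cast hn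
  have hupper : Real.log n.factorial ≤
      n * ∑ p ∈ Nat.primesLE n, (Real.log p / p + 4 * (1 / (p : ℝ) ^ (3 / 2 : ℝ))) := by
    rw [log_factorial_eq_sum_primesLE, Finset.mul_sum]
    refine Finset.sum_le_sum fun p hp => ?_
    have hprime := Nat.prime_of_mem_primesLE hp
    have hp2 : (2 : ℝ) ≤ p := by exact_mod_cast hprime.two_le
    have hp0 : (0 : ℝ) < p := by linarith
    have hfac : (n.factorial.factorization p : ℝ) ≤ n / ((p : ℝ) - 1) := by
      have h : (n.factorial.factorization p : ℝ) ≤ ((n / (p - 1) : ℕ) : ℝ) := by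
        exact_mod_cast Nat.factorization_factorial_le_div_pred hprime n
      refine h.trans (Nat.cast_div_le.trans_eq ?_)
      rw [Nat.cast_sub hprime.one_le, Nat.cast_one]
    have hlog : Real.log p ≤ (p : ℝ) ^ (1 / 2 : ℝ) * 2 := by
      have := Real.log_le_rpow_div hp0.le (by norm_num : (0 : ℝ) < 1 / 2)
      linarith
    have hpow : (p : ℝ) ^ (1 / 2 : ℝ) * (1 / p ^ 2) = 1 / (p : ℝ) ^ (3 / 2 : ℝ) := by
      rw [one_div (_ ^ 2), one_div (_ ^ (3 / 2 : ℝ)), ← Real.rpow_natCast, ← Real.rpow_neg hp0.le,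
        ← Real.rpow_neg hp0.le, ← Real.rpow_add hp0]
      norm_num
    have hinv : 1 / ((p : ℝ) - 1) ≤ 1 / p + 2 * (1 / p ^ 2) := by
      have h1 : (0 : ℝ) < p - 1 := by linarith
      have : 1 / (p : ℝ) + 2 * (1 / p ^ 2) - 1 / (p - 1) = (p - 2) / (p ^ 2 * (p - 1)) := by
        field_simp
        ring
      have : 0 ≤ ((p : ℝ) - 2) / (p ^ 2 * (p - 1)) :=
        div_nonneg (by linarith) (by positivity)
      linarith
    have hlog0 := Real.log_natCast_nonneg p
    calc (n.factorial.factorization p : ℝ) * Real.log p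
        ≤ n / ((p : ℝ) - 1) * Real.log p := mul_le_mul_of_nonneg_right hfac hlog0
      _ = n * (1 / ((p : ℝ) - 1) * Real.log p) := by ring
      _ ≤ n * ((1 / p + 2 * (1 / p ^ 2)) * Real.log p) := by gcongr
      _ = n * (Real.log p / p + 2 * (1 / p ^ 2) * Real.log p) := by ring
      _ ≤ n * (Real.log p / p + 2 * (1 / p ^ 2) * ((p : ℝ) ^ (1 / 2 : ℝ) * 2)) := by gcongr
      _ = n * (Real.log p / p + 4 * ((p : ℝ) ^ (1 / 2 : ℝ) * (1 / p ^ 2))) := by ring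
      _ = _ := by rw [hpow]
  have hstirling : n * (Real.log n - 1) ≤ Real.log n.factorial := by
    have h := Stirling.le_log_factorial_stirling (Nat.one_le_iff_ne_zero.1 hn)
    have h1 : 0 ≤ Real.log n := Real.log_natCast_nonneg n
    have h2 : 0 ≤ Real.log (2 * Real.pi) := Real.log_nonneg (by linarith [Real.pi_gt_three])
    linarith
  have hle := le_of_mul_le_mul_left (hstirling.trans hupper) hn'
  rw [Finset.sum_add_distrib] at hle
  have htail := hsum.sum_le_tsum (Nat.primesLE n) (fun k _ => by positivity)
  linarith

/-- Partial summation from Mertens' first theorem to sums of reciprocals of primes. -/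
lemma sum_primesLE_inv_sub_le {M : ℝ} {m N : ℕ} (hm : 2 ≤ m) (hmN : m ≤ N)
    (hM : ∀ n : ℕ, 1 ≤ n → |∑ p ∈ Nat.primesLE n, Real.log p / p - Real.log n| ≤ M) :
    ∑ p ∈ Nat.primesLE N, (1 : ℝ) / p - ∑ p ∈ Nat.primesLE m, (1 : ℝ) / p ≤
      Real.log (Real.log N) - Real.log (Real.log m) +
        (∑ p ∈ Nat.primesLE N, Real.log p / p - Real.log N) * (1 / Real.log N) +
        M * (2 * (1 / Real.log m) - 1 / Real.log N) := by
  induction N, hmN using Nat.le_induction with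
  | base =>
    have hlog : 0 < Real.log m := Real.log_pos (by exact_mod_cast hm)
    have h := (abs_le.1 (hM m (by omega))).1
    have := mul_nonneg (by linarith : 0 ≤ ∑ p ∈ Nat.primesLE m, Real.log p / p - Real.log m + M)
      (one_div_nonneg.2 hlog.le)
    linarith
  | succ N hmN ih =>
    have hN2 : (2 : ℝ) ≤ N := by exact_mod_cast hm.trans hmN
    have hlog : 0 < Real.log N := Real.log_pos (by linarith)
    have hlog_le : Real.log N ≤ Real.log (N + 1 : ℕ) :=
      Real.log_le_log (by linarith) (by push_cast; linarith)
    have hlog' : 0 < Real.log (N + 1 : ℕ) := hlog.trans_le hlog_le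
    have hstep : ∑ p ∈ Nat.primesLE (N + 1), (1 : ℝ) / p - ∑ p ∈ Nat.primesLE N, (1 : ℝ) / p =
        (∑ p ∈ Nat.primesLE (N + 1), Real.log p / p - ∑ p ∈ Nat.primesLE N, Real.log p / p) *
          (1 / Real.log (N + 1 : ℕ)) := by
      rw [Nat.primesLE_succ]
      split_ifs
      · rw [Finset.sum_insert (Nat.notMem_primesLE N), Finset.sum_insert (Nat.notMem_primesLE N)]
        field_simp
        ring
      · simp
    have hloglog : 1 - Real.log N * (1 / Real.log (N + 1 : ℕ)) ≤
        Real.log (Real.log (N + 1 : ℕ)) - Real.log (Real.log N) := by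
      rw [← Real.log_div hlog'.ne' hlog.ne']
      have := Real.one_sub_inv_le_log_of_pos (div_pos hlog' hlog)
      rwa [inv_div, div_eq_mul_one_div] at this
    have hD := (abs_le.1 (hM N (by omega))).2
    have hw : 1 / Real.log (N + 1 : ℕ) ≤ 1 / Real.log N := one_div_le_one_div_of_le hlog hlog_le
    have hcross := mul_le_mul_of_nonneg_right hD (sub_nonneg.2 hw)
    have hone : Real.log (N + 1 : ℕ) * (1 / Real.log (N + 1 : ℕ)) = 1 :=
      mul_one_div_cancel hlog'.ne'
    linarith

/-- Upper bound in Mertens' second theorem for the primes of an interval. -/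
lemma exists_sum_one_div_primes_Icc_le :
    ∃ K : ℝ, ∀ t x : ℝ, 2 ≤ t → t ≤ x →
      ∑ p ∈ Nat.primesLE ⌊x⌋₊ with t ≤ (p : ℕ), (1 : ℝ) / p ≤
        Real.log (Real.log x) - Real.log (Real.log t) + K := by
  obtain ⟨K, hK⟩ := exists_log_sub_le_sum_primesLE_log_div
  set M := max K (Real.log 4)
  have hM : ∀ n : ℕ, 1 ≤ n → |∑ p ∈ Nat.primesLE n, Real.log p / p - Real.log n| ≤ M := by
    intro n hn
    have h1 := hK n hn
    have h2 := sum_primesLE_log_div_le hn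
    have h3 := le_max_left K (Real.log 4)
    have h4 := le_max_right K (Real.log 4)
    exact abs_le.2 ⟨by linarith, by linarith⟩
  have hM0 : 0 ≤ M := (abs_nonneg _).trans (hM 1 le_rfl)
  refine ⟨1 + Real.log 2 + M * (2 * (1 / Real.log 2)), fun t x ht htx => ?_⟩
  set m := ⌊t⌋₊
  set N := ⌊x⌋₊
  have hm : 2 ≤ m := Nat.le_floor (by exact_mod_cast ht)
  have hmN : m ≤ N := Nat.floor_mono htx
  have hm2 : (2 : ℝ) ≤ m := by exact_mod_cast hm
  have hN2 : (2 : ℝ) ≤ N := by exact_mod_cast hm.trans hmN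
  have hmt : (m : ℝ) ≤ t := Nat.floor_le (by linarith)
  have hNx : (N : ℝ) ≤ x := Nat.floor_le (by linarith)
  have hlog2 : 0 < Real.log 2 := Real.log_pos (by norm_num)
  have hlogm : Real.log 2 ≤ Real.log m := Real.log_le_log (by norm_num) hm2
  have hlogN : 0 < Real.log N := Real.log_pos (by linarith)
  have hsplit : ∑ p ∈ Nat.primesLE N with t ≤ (p : ℕ), (1 : ℝ) / p ≤
      1 + (∑ p ∈ Nat.primesLE N, (1 : ℝ) / p - ∑ p ∈ Nat.primesLE m, (1 : ℝ) / p) := by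
    rw [← Finset.sum_sdiff (Nat.primesLE_mono hmN), add_sub_cancel_right]
    calc ∑ p ∈ Nat.primesLE N with t ≤ (p : ℕ), (1 : ℝ) / p
        ≤ ∑ p ∈ insert m (Nat.primesLE N \ Nat.primesLE m), (1 : ℝ) / p := by
          refine Finset.sum_le_sum_of_subset_of_nonneg (fun p hp => ?_)
            fun p _ _ => by positivity
          simp only [Finset.mem_filter, Nat.mem_primesLE] at hp
          have hmp : m ≤ p := by exact_mod_cast hmt.trans hp.2
          simp only [Finset.mem_insert, Finset.mem_sdiff, Nat.mem_primesLE]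
          rcases hmp.eq_or_lt with h | h
          · exact Or.inl h.symm
          · exact Or.inr ⟨hp.1, fun h' => by omega⟩
      _ = 1 / m + ∑ p ∈ Nat.primesLE N \ Nat.primesLE m, (1 : ℝ) / p := by
          rw [Finset.sum_insert]
          simp only [Finset.mem_sdiff, Nat.mem_primesLE]
          tauto
      _ ≤ _ := by
          gcongr
          exact (div_le_one (by linarith)).2 (by linarith)
  have hmain := sum_primesLE_inv_sub_le hm hmN hM
  have hlast : (∑ p ∈ Nat.primesLE N, Real.log p / p - Real.log N) * (1 / Real.log N) ≤
      M * (1 / Real.log N) :=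
    mul_le_mul_of_nonneg_right (abs_le.1 (hM N (by omega))).2 (one_div_nonneg.2 hlogN.le)
  have hfirst : M * (2 * (1 / Real.log m)) ≤ M * (2 * (1 / Real.log 2)) := by gcongr
  have hx : Real.log (Real.log N) ≤ Real.log (Real.log x) :=
    Real.log_le_log hlogN (Real.log_le_log (by linarith) hNx)
  have ht' : Real.log (Real.log t) ≤ Real.log (Real.log m) + Real.log 2 := by
    rw [← Real.log_mul (hlog2.trans_le hlogm).ne' two_ne_zero]
    refine Real.log_le_log (Real.log_pos (by linarith)) ?_
    have hsq : t ≤ (m : ℝ) ^ 2 := by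
      have := (Nat.lt_floor_add_one t).le
      change t ≤ (m : ℝ) + 1 at this
      nlinarith
    calc Real.log t ≤ Real.log ((m : ℝ) ^ 2) := Real.log_le_log (by linarith) hsq
      _ = Real.log m * 2 := by rw [Real.log_pow]; push_cast; ring
  linarith

/-- Weighting each integer by a power of its number of prime factors in `P` costs at most the
Euler product over `P`. -/
lemma sum_pow_card_primeFactors_inter_le {b : ℝ} (hb : 1 ≤ b) (N : ℕ) {P : Finset ℕ}
    (hP : ∀ p ∈ P, p.Prime) :
    ∑ n ∈ Finset.Icc 1 N, b ^ (n.primeFactors ∩ P).card ≤ N * ∏ p ∈ P, (1 + (b - 1) / p) := by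
  have hexpand : ∀ n ∈ Finset.Icc 1 N, b ^ (n.primeFactors ∩ P).card =
      ∑ T ∈ P.powerset, if ∏ p ∈ T, p ∣ n then (b - 1) ^ T.card else 0 := by
    intro n hn
    have hn0 : n ≠ 0 := by have := (Finset.mem_Icc.1 hn).1; omega
    rw [← Finset.sum_filter]
    have hset : P.powerset.filter (fun T => ∏ p ∈ T, p ∣ n) = (n.primeFactors ∩ P).powerset := by
      ext T
      simp only [Finset.mem_filter, Finset.mem_powerset, Finset.subset_inter_iff]
      constructor
      · rintro ⟨hTP, hdvd⟩
        exact ⟨fun p hp => Nat.mem_primeFactors.2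
          ⟨hP p (hTP hp), (Finset.dvd_prod_of_mem _ hp).trans hdvd, hn0⟩, hTP⟩
      · rintro ⟨hTn, hTP⟩
        exact ⟨hTP, Finset.prod_primes_dvd n (fun p hp => (hP p (hTP hp)).prime)
          fun p hp => Nat.dvd_of_mem_primeFactors (hTn hp)⟩
    have := Finset.prod_one_add (f := fun _ => b - 1) (n.primeFactors ∩ P)
    simpa [hset] using this
  rw [Finset.sum_congr rfl hexpand, Finset.sum_comm, Finset.prod_one_add, Finset.mul_sum]
  refine Finset.sum_le_sum fun T _ => ?_
  have hcount : (((Finset.Icc 1 N).filter (fun n => ∏ p ∈ T, p ∣ n)).card : ℝ) ≤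
      N / ((∏ p ∈ T, p : ℕ) : ℝ) := by
    have h := Nat.Ioc_filter_dvd_card_eq_div N (∏ p ∈ T, p)
    rw [← Finset.Icc_add_one_left_eq_Ioc, zero_add] at h
    rw [h]
    exact Nat.cast_div_le
  rw [← Finset.sum_filter, Finset.sum_const, nsmul_eq_mul, Finset.prod_div_distrib,
    Finset.prod_const]
  calc _ ≤ N / ((∏ p ∈ T, p : ℕ) : ℝ) * (b - 1) ^ T.card :=
        mul_le_mul_of_nonneg_right hcount (pow_nonneg (by linarith) _)
    _ = _ := by push_cast; ring

lemma omegaInterval_le_card_inter (t x : ℝ) (n : ℕ) :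
    omegaInterval t x n ≤
      (n.primeFactors ∩ (Nat.primesLE ⌊x⌋₊).filter fun p : ℕ => max t 2 ≤ p).card := by
  refine Finset.card_le_card fun p hp => ?_
  obtain ⟨hpn, htp, hpx⟩ := Finset.mem_filter.1 hp
  have hprime := Nat.prime_of_mem_primeFactors hpn
  have h2p : (2 : ℝ) ≤ p := by exact_mod_cast hprime.two_le
  exact Finset.mem_inter.2 ⟨hpn, Finset.mem_filter.2
    ⟨Nat.mem_primesLE.2 ⟨Nat.le_floor hpx, hprime⟩, max_le htp h2p⟩⟩

/-- The mean value of `b ^ ω([t,x], n)` over `n ≤ x` is `O((log x / log t) ^ (b - 1))`. -/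
lemma exists_sum_pow_omegaInterval_le {b : ℝ} (hb : 1 < b) :
    ∃ C : ℝ, 0 < C ∧ ∀ x t : ℝ, 1 < t → t < x →
      ∑ n ∈ Finset.Icc 1 ⌊x⌋₊, b ^ omegaInterval t x n ≤
        C * x * (Real.log x / Real.log t) ^ (b - 1) := by
  obtain ⟨K, hK⟩ := exists_sum_one_div_primes_Icc_le
  refine ⟨max 1 (Real.exp ((b - 1) * K)), lt_max_of_lt_left one_pos, fun x t ht htx => ?_⟩
  have hlogt : 0 < Real.log t := Real.log_pos ht
  have hlogx : 0 < Real.log x := Real.log_pos (ht.trans htx)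
  have hx0 : 0 < x := by linarith
  have hfloor : ((⌊x⌋₊ : ℕ) : ℝ) ≤ x := Nat.floor_le hx0.le
  set s := max t 2
  calc ∑ n ∈ Finset.Icc 1 ⌊x⌋₊, b ^ omegaInterval t x n
      ≤ ∑ n ∈ Finset.Icc 1 ⌊x⌋₊,
          b ^ (n.primeFactors ∩ (Nat.primesLE ⌊x⌋₊).filter fun p : ℕ => s ≤ p).card :=
        Finset.sum_le_sum fun n _ =>
          pow_le_pow_right₀ hb.le (omegaInterval_le_card_inter t x n)
    _ ≤ ⌊x⌋₊ * ∏ p ∈ Nat.primesLE ⌊x⌋₊ with s ≤ (p : ℕ), (1 + (b - 1) / p) :=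
        sum_pow_card_primeFactors_inter_le hb.le _ fun p hp =>
          Nat.prime_of_mem_primesLE (Finset.mem_filter.1 hp).1
    _ ≤ x * (max 1 (Real.exp ((b - 1) * K)) * (Real.log x / Real.log t) ^ (b - 1)) := by
        refine mul_le_mul hfloor ?_ (Finset.prod_nonneg fun p _ => ?_) hx0.le
        · rcases le_or_gt s x with hsx | hsx
          · have hs2 : 2 ≤ s := le_max_right _ _
            have hlogs : Real.log t ≤ Real.log s :=
              Real.log_le_log (by linarith) (le_max_left _ _)
            calc ∏ p ∈ Nat.primesLE ⌊x⌋₊ with s ≤ (p : ℕ), (1 + (b - 1) / p)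
                ≤ Real.exp (∑ p ∈ Nat.primesLE ⌊x⌋₊ with s ≤ (p : ℕ), (b - 1) / p) :=
                  Real.prod_one_add_le_exp_sum _ fun p =>
                    div_nonneg (by linarith) p.cast_nonneg
              _ ≤ Real.exp ((b - 1) * (Real.log (Real.log x) - Real.log (Real.log t) + K)) := by
                  rw [Real.exp_le_exp]
                  simp_rw [div_eq_mul_one_div (b - 1), ← Finset.mul_sum]
                  refine mul_le_mul_of_nonneg_left ?_ (by linarith)
                  linarith [hK s x hs2 hsx, Real.log_le_log hlogt hlogs]
              _ = Real.exp ((b - 1) * K) * (Real.log x / Real.log t) ^ (b - 1) := by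
                  rw [Real.rpow_def_of_pos (div_pos hlogx hlogt),
                    Real.log_div hlogx.ne' hlogt.ne', ← Real.exp_add]
                  ring_nf
              _ ≤ _ := by gcongr; exact le_max_right _ _
          · have hempty : (Nat.primesLE ⌊x⌋₊).filter (fun p : ℕ => s ≤ p) = ∅ := by
              refine Finset.filter_eq_empty_iff.2 fun p hp => ?_
              have : (p : ℝ) ≤ ⌊x⌋₊ := by exact_mod_cast Nat.le_of_mem_primesLE hp
              linarith
            rw [hempty, Finset.prod_empty]
            refine one_le_mul_of_one_le_of_one_le (le_max_left _ _)
              (Real.one_le_rpow ?_ (by linarith))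
            exact (one_le_div hlogt).2 (Real.log_le_log (by linarith) htx.le)
        · have : 0 ≤ (b - 1) / (p : ℝ) := div_nonneg (by linarith) p.cast_nonneg
          linarith
    _ = _ := by ring

/-- For b > 1 and ε > 0 there is C > 0 such that for all 1 < t < x,
#{n ≤ x : ω([t,x],n) > ((1+ε)(b-1)/log b)(log log x - log log t)}
  ≤ C x (log x / log t)^{-ε(b-1)}. -/
theorem count_large_omegaInterval (b ε : ℝ) (hb : 1 < b) (hε : 0 < ε) :
    ∃ C : ℝ, 0 < C ∧ ∀ x t : ℝ, 1 < x → 1 < t → t < x →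
      (((Finset.Icc 1 ⌊x⌋₊).filter
          (fun n => (omegaInterval t x n : ℝ) >
            (1 + ε) * (b - 1) / Real.log b *
              (Real.log (Real.log x) - Real.log (Real.log t)))).card : ℝ)
        ≤ C * x * (Real.log x / Real.log t) ^ (-(ε * (b - 1))) := by
  obtain ⟨C, hC, hbound⟩ := exists_sum_pow_omegaInterval_le hb
  refine ⟨C, hC, fun x t hx ht htx => ?_⟩
  have hlogt : 0 < Real.log t := Real.log_pos ht
  have hlogx : 0 < Real.log x := Real.log_pos hx
  have hR : 0 < Real.log x / Real.log t := div_pos hlogx hlogt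
  have hlogb : 0 < Real.log b := Real.log_pos hb
  have hweight : 0 < (Real.log x / Real.log t) ^ ((1 + ε) * (b - 1)) := Real.rpow_pos_of_pos hR _
  set S := (Finset.Icc 1 ⌊x⌋₊).filter (fun n => (omegaInterval t x n : ℝ) >
    (1 + ε) * (b - 1) / Real.log b * (Real.log (Real.log x) - Real.log (Real.log t)))
  have hmarkov : (S.card : ℝ) * (Real.log x / Real.log t) ^ ((1 + ε) * (b - 1)) ≤
      C * x * (Real.log x / Real.log t) ^ (b - 1) := by
    rw [← nsmul_eq_mul, ← Finset.sum_const]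
    refine le_trans (Finset.sum_le_sum fun n hn => ?_)
      ((Finset.sum_le_sum_of_subset_of_nonneg (Finset.filter_subset _ _)
        fun n _ _ => by positivity).trans (hbound x t ht htx))
    have hlarge := (Finset.mem_filter.1 hn).2
    rw [← Real.rpow_natCast, Real.rpow_def_of_pos hR, Real.rpow_def_of_pos (by linarith : 0 < b),
      Real.log_div hlogx.ne' hlogt.ne', Real.exp_le_exp]
    refine le_of_eq_of_le ?_ (mul_le_mul_of_nonneg_left hlarge.le hlogb.le)
    field_simp
  refine le_of_mul_le_mul_right (hmarkov.trans_eq ?_) hweight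
  rw [mul_assoc (C * x), ← Real.rpow_add hR]
  ring_nf
end
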